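/- arXiv:1501.00618 — 4 statements merged into one kernel-verified Lean document; each statement's English description precedes it below -/
import Mathlib

section
/- Let C > 0 and let F : [0, ∞) → ℝ be a continuously differentiable function such that F(t) ≥ 0 for all t ≥ 0, the Lebesgue integral ∫₀^∞ F(t) dt is finite, and F′(t) ≤ C · F(t) · (1 + F(t)^{1/2}) for all t ≥ 0. Then F(t) → 0 as t → ∞. -/
open MeasureTheory Filter Set

/-- The integral of an integrable function over a sliding unit window tends to zero. -/
theorem tendsto_integral_unit_window {F : ℝ → ℝ} (hint : IntegrableOn F (Ici 0)) :
    Tendsto (fun t => ∫ s in (t - 1)..t, F s) atTop (nhds 0) := by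
  have hlim := intervalIntegral_tendsto_integral_Ioi (μ := volume) (f := F) 0
    (hint.mono_set Ioi_subset_Ici_self) tendsto_id
  have hshift : Tendsto (fun t : ℝ => t - 1) atTop atTop :=
    tendsto_atTop_add_const_right _ (-1) tendsto_id
  have hsub := hlim.sub (hlim.comp hshift)
  rw [sub_self] at hsub
  have hii : ∀ t : ℝ, 0 ≤ t → IntervalIntegrable F volume 0 t := fun t ht =>
    (intervalIntegrable_iff_integrableOn_Ioc_of_le ht).2
      (hint.mono_set fun x hx => hx.1.le)
  refine hsub.congr' ?_
  filter_upwards [eventually_ge_atTop 1] with t ht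
  exact intervalIntegral.integral_interval_sub_left (hii t (by linarith))
    (hii (t - 1) (by linarith))

/-- If `F ≥ 0` satisfies `F' ≤ K F (1 + F)`, then `F / (1 + F)` grows at most like `exp (K t)`. -/
theorem antitoneOn_div_one_add_mul_exp {K : ℝ} {F : ℝ → ℝ}
    (hF : DifferentiableOn ℝ F (Ici 0)) (hpos : ∀ t, 0 ≤ t → 0 ≤ F t)
    (hderiv : ∀ t, 0 < t → deriv F t ≤ K * F t * (1 + F t)) :
    AntitoneOn (fun t => F t / (1 + F t) * Real.exp (-(K * t))) (Ici 0) := by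
  have hd : ∀ t : ℝ, 0 < t → HasDerivAt (fun t => F t / (1 + F t) * Real.exp (-(K * t)))
      ((deriv F t * (1 + F t) - F t * deriv F t) / (1 + F t) ^ 2 * Real.exp (-(K * t)) +
        F t / (1 + F t) * (Real.exp (-(K * t)) * -(K * 1))) t := by
    intro t ht
    have h1 : HasDerivAt F (deriv F t) t :=
      (hF.differentiableAt (Ici_mem_nhds ht)).hasDerivAt
    have h0 : 1 + F t ≠ 0 := by linarith [hpos t ht.le]
    exact (h1.div (h1.const_add 1) h0).mul ((hasDerivAt_id t).const_mul K).neg.exp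
  refine antitoneOn_of_deriv_nonpos (convex_Ici 0) ?_ ?_ ?_
  · have hc := hF.continuousOn
    refine (hc.div (continuousOn_const.add hc) fun t ht => ?_).mul (by fun_prop)
    exact (add_pos_of_pos_of_nonneg one_pos (hpos t ht)).ne'
  · rw [interior_Ici]
    exact fun t ht => (hd t ht).differentiableAt.differentiableWithinAt
  · rw [interior_Ici]
    intro t ht
    rw [(hd t ht).deriv]
    have hp : 0 < 1 + F t := by linarith [hpos t (le_of_lt ht)]
    have hrw : (deriv F t * (1 + F t) - F t * deriv F t) / (1 + F t) ^ 2 * Real.exp (-(K * t)) +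
        F t / (1 + F t) * (Real.exp (-(K * t)) * -(K * 1)) =
        (deriv F t - K * F t * (1 + F t)) * (Real.exp (-(K * t)) / (1 + F t) ^ 2) := by
      field_simp
      ring
    rw [hrw]
    exact mul_nonpos_of_nonpos_of_nonneg (by linarith [hderiv t ht]) (by positivity)

/-- If `F : [0,∞) → ℝ` is C¹, nonnegative, Lebesgue-integrable on `[0,∞)`, and its derivative
satisfies `F' t ≤ C · F t · (1 + √(F t))`, then `F t → 0` as `t → ∞`. -/
theorem flow_quantity_tendsto_zero (C : ℝ) (hC : 0 < C) (F : ℝ → ℝ)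
    (hF : ContDiffOn ℝ 1 F (Ici 0))
    (hpos : ∀ t, 0 ≤ t → 0 ≤ F t)
    (hint : IntegrableOn F (Ici 0))
    (hderiv : ∀ t, 0 ≤ t →
      derivWithin F (Ici 0) t ≤ C * F t * (1 + Real.sqrt (F t))) :
    Tendsto F atTop (nhds 0) := by
  have hanti : AntitoneOn (fun t => F t / (1 + F t) * Real.exp (-(2 * C * t))) (Ici 0) := by
    refine antitoneOn_div_one_add_mul_exp (hF.differentiableOn one_ne_zero) hpos fun t ht => ?_
    have h := hderiv t ht.le
    rw [derivWithin_of_mem_nhds (Ici_mem_nhds ht)] at h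
    have hFt := hpos t ht.le
    have hsqrt : 1 + Real.sqrt (F t) ≤ 2 * (1 + F t) := by
      nlinarith [Real.sq_sqrt hFt, sq_nonneg (Real.sqrt (F t) - 1)]
    calc deriv F t ≤ C * F t * (1 + Real.sqrt (F t)) := h
      _ ≤ C * F t * (2 * (1 + F t)) := by gcongr
      _ = 2 * C * F t * (1 + F t) := by ring
  have hbound : ∀ t, 1 ≤ t →
      F t / (1 + F t) ≤ Real.exp (2 * C) * ∫ s in (t - 1)..t, F s := by
    intro t ht
    have hpt : ∀ s ∈ Icc (t - 1) t, F t / (1 + F t) ≤ Real.exp (2 * C) * F s := by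
      intro s hs
      have hs0 : 0 ≤ s := by linarith [hs.1]
      have hFs := hpos s hs0
      have h : F t / (1 + F t) * Real.exp (-(2 * C * t)) ≤
          F s / (1 + F s) * Real.exp (-(2 * C * s)) :=
        hanti hs0 (show (0 : ℝ) ≤ t by linarith) hs.2
      calc F t / (1 + F t)
          = F t / (1 + F t) * Real.exp (-(2 * C * t)) * Real.exp (2 * C * t) := by
            rw [mul_assoc, ← Real.exp_add, neg_add_cancel, Real.exp_zero, mul_one]
        _ ≤ F s / (1 + F s) * Real.exp (-(2 * C * s)) * Real.exp (2 * C * t) := by gcongr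
        _ = Real.exp (2 * C * (t - s)) * (F s / (1 + F s)) := by
            rw [mul_assoc, ← Real.exp_add, mul_comm]
            ring_nf
        _ ≤ Real.exp (2 * C) * F s := by
            refine mul_le_mul (Real.exp_le_exp.2 ?_) (div_le_self hFs (by linarith))
              (by positivity) (Real.exp_nonneg _)
            nlinarith [hs.1]
    have hii : IntervalIntegrable F volume (t - 1) t :=
      (intervalIntegrable_iff_integrableOn_Ioc_of_le (by linarith)).2
        (hint.mono_set fun x hx => show (0 : ℝ) ≤ x by linarith [hx.1])
    have hmono := intervalIntegral.integral_mono_on (by linarith : t - 1 ≤ t)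
      intervalIntegrable_const (hii.const_mul (Real.exp (2 * C))) hpt
    simpa using hmono
  have hg : Tendsto (fun t => F t / (1 + F t)) atTop (nhds 0) := by
    have hlim := (tendsto_integral_unit_window hint).const_mul (Real.exp (2 * C))
    rw [mul_zero] at hlim
    refine squeeze_zero' ?_ ((eventually_ge_atTop 1).mono hbound) hlim
    filter_upwards [eventually_ge_atTop 0] with t ht
    have := hpos t ht
    positivity
  have hinv := hg.div (hg.const_sub 1) (by norm_num)
  rw [zero_div] at hinv
  refine hinv.congr' ?_
  filter_upwards [eventually_ge_atTop 0] with t ht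
  have hp : 1 + F t ≠ 0 := by linarith [hpos t ht]
  have hone : 1 - F t / (1 + F t) = 1 / (1 + F t) := by
    field_simp
    ring
  simp only [Pi.div_apply, hone]
  field_simp
end

section
/- Let n ≥ 1 be an integer, δ > 0, a ≥ 0, and q a real number with 2q − a > n. Then the function y ↦ ‖y‖^a (1 + ‖y‖²)^{−q} is Lebesgue-integrable on ℝⁿ, and lim_{ε → 0⁺} ε^{2q−a−n} ∫_{B_δ} ‖x‖^a (ε² + ‖x‖²)^{−q} dx = ∫_{ℝⁿ} ‖y‖^a (1 + ‖y‖²)^{−q} dy. -/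
open MeasureTheory Filter Set

section WeightedBubble

variable {E : Type*} [NormedAddCommGroup E]

lemma norm_rpow_mul_one_add_norm_sq_rpow_le {a : ℝ} (ha : 0 ≤ a) (q : ℝ) (y : E) :
    ‖y‖ ^ a * (1 + ‖y‖ ^ 2) ^ (-q) ≤ (1 + ‖y‖ ^ 2) ^ (-(2 * q - a) / 2) := by
  have hb : 0 < 1 + ‖y‖ ^ 2 := by positivity
  have hsqrt : ‖y‖ ≤ (1 + ‖y‖ ^ 2) ^ (1 / 2 : ℝ) := by
    rw [← Real.sqrt_eq_rpow]
    exact Real.le_sqrt_of_sq_le (by linarith)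
  calc ‖y‖ ^ a * (1 + ‖y‖ ^ 2) ^ (-q)
      ≤ ((1 + ‖y‖ ^ 2) ^ (1 / 2 : ℝ)) ^ a * (1 + ‖y‖ ^ 2) ^ (-q) := by gcongr
    _ = (1 + ‖y‖ ^ 2) ^ (-(2 * q - a) / 2) := by
      rw [← Real.rpow_mul hb.le, ← Real.rpow_add hb]
      ring_nf

variable [NormedSpace ℝ E]

lemma norm_smul_rpow_mul_sq_add_norm_smul_sq_rpow {ε : ℝ} (hε : 0 < ε) (a q : ℝ) (y : E) :
    ‖ε • y‖ ^ a * (ε ^ 2 + ‖ε • y‖ ^ 2) ^ (-q) =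
      ε ^ (a - 2 * q) * (‖y‖ ^ a * (1 + ‖y‖ ^ 2) ^ (-q)) := by
  have h : ε ^ 2 + (ε * ‖y‖) ^ 2 = ε ^ 2 * (1 + ‖y‖ ^ 2) := by ring
  have hpow : (ε ^ 2) ^ (-q) = ε ^ (-(2 * q)) := by
    rw [← Real.rpow_natCast ε 2, ← Real.rpow_mul hε.le]
    push_cast
    ring_nf
  rw [norm_smul, Real.norm_of_nonneg hε.le, h, Real.mul_rpow hε.le (norm_nonneg y),
    Real.mul_rpow (by positivity) (by positivity), hpow, sub_eq_add_neg, Real.rpow_add hε]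
  ring

variable [FiniteDimensional ℝ E] [MeasurableSpace E] [BorelSpace E]
  (μ : Measure E) [μ.IsAddHaarMeasure]

lemma integrable_norm_rpow_mul_one_add_norm_sq_rpow {a q : ℝ} (ha : 0 ≤ a)
    (hq : (Module.finrank ℝ E : ℝ) < 2 * q - a) :
    Integrable (fun y : E => ‖y‖ ^ a * (1 + ‖y‖ ^ 2) ^ (-q)) μ := by
  refine (integrable_rpow_neg_one_add_norm_sq hq).mono'
    (Measurable.aestronglyMeasurable (by fun_prop)) (Eventually.of_forall fun y => ?_)
  rw [Real.norm_of_nonneg (by positivity)]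
  exact norm_rpow_mul_one_add_norm_sq_rpow_le ha q y

lemma rpow_mul_setIntegral_ball_eq {ε : ℝ} (hε : 0 < ε) (δ a q : ℝ) :
    ε ^ (2 * q - a - (Module.finrank ℝ E : ℝ)) *
        ∫ x in Metric.ball (0 : E) δ, ‖x‖ ^ a * (ε ^ 2 + ‖x‖ ^ 2) ^ (-q) ∂μ =
      ∫ y in Metric.ball (0 : E) (δ / ε), ‖y‖ ^ a * (1 + ‖y‖ ^ 2) ^ (-q) ∂μ := by
  have h := Measure.setIntegral_comp_smul_of_pos μ
    (fun x : E => ‖x‖ ^ a * (ε ^ 2 + ‖x‖ ^ 2) ^ (-q)) (Metric.ball 0 (δ / ε)) hε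
  simp_rw [norm_smul_rpow_mul_sq_add_norm_smul_sq_rpow hε] at h
  rw [integral_const_mul, smul_ball hε.ne', smul_zero, Real.norm_of_nonneg hε.le,
    mul_div_cancel₀ _ hε.ne', smul_eq_mul] at h
  rw [sub_eq_add_neg, Real.rpow_add hε, Real.rpow_neg hε.le, Real.rpow_natCast, mul_assoc, ← h,
    ← mul_assoc, ← Real.rpow_add hε]
  simp

end WeightedBubble

/-- Leading-order asymptotics of the weighted bubble integrals in the subcritical case
`2q − a > n`: `y ↦ ‖y‖^a (1+‖y‖²)^{−q}` is integrable on `ℝⁿ` and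
`ε^{2q−a−n} ∫_{B_δ} ‖x‖^a (ε²+‖x‖²)^{−q} dx → ∫_{ℝⁿ} ‖y‖^a (1+‖y‖²)^{−q} dy` as `ε → 0⁺`. -/
theorem weighted_bubble_asymptotics (n : ℕ) (hn : 1 ≤ n) (δ : ℝ) (hδ : 0 < δ)
    (a q : ℝ) (ha : 0 ≤ a) (hq : (n : ℝ) < 2 * q - a) :
    Integrable (fun y : EuclideanSpace ℝ (Fin n) => ‖y‖ ^ a * (1 + ‖y‖ ^ 2) ^ (-q)) ∧
    Tendsto (fun ε : ℝ => ε ^ (2 * q - a - (n : ℝ)) *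
        ∫ x in Metric.ball (0 : EuclideanSpace ℝ (Fin n)) δ, ‖x‖ ^ a * (ε ^ 2 + ‖x‖ ^ 2) ^ (-q))
      (nhdsWithin 0 (Ioi 0))
      (nhds (∫ y : EuclideanSpace ℝ (Fin n), ‖y‖ ^ a * (1 + ‖y‖ ^ 2) ^ (-q))) := by
  have hint : Integrable
      (fun y : EuclideanSpace ℝ (Fin n) => ‖y‖ ^ a * (1 + ‖y‖ ^ 2) ^ (-q)) :=
    integrable_norm_rpow_mul_one_add_norm_sq_rpow volume ha (by simpa using hq)
  have hradius : Tendsto (fun ε : ℝ => δ / ε) (nhdsWithin 0 (Ioi 0)) atTop := by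
    simpa only [div_eq_mul_inv] using tendsto_inv_nhdsGT_zero.const_mul_atTop hδ
  refine ⟨hint, Tendsto.congr' ?_
    ((aecover_ball (x := 0) hradius).integral_tendsto_of_countably_generated hint)⟩
  filter_upwards [self_mem_nhdsWithin] with ε hε
  simpa using (rpow_mul_setIntegral_ball_eq
    (volume : Measure (EuclideanSpace ℝ (Fin n))) hε δ a q).symm
end

section
/- Let n ≥ 1 be an integer, δ > 0, a ≥ 0, and set q = (n + a)/2 (so that 2q − a = n). Then lim_{ε → 0⁺} (log(1/ε))^{−1} ∫_{B_δ} ‖x‖^a (ε² + ‖x‖²)^{−q} dx = n · ω_n, where ω_n is the Lebesgue measure of the unit ball in ℝⁿ (so n·ω_n is the surface measure of the unit sphere S^{n−1}). -/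
open MeasureTheory Filter Set

/-- Polar coordinates for the integral of a radial function over a centred ball. -/
theorem setIntegral_ball_fun_norm (n : ℕ) (hn : 1 ≤ n) {δ : ℝ} (hδ : 0 ≤ δ) (f : ℝ → ℝ) :
    ∫ x in Metric.ball (0 : EuclideanSpace ℝ (Fin n)) δ, f ‖x‖ =
      n * (volume (Metric.ball (0 : EuclideanSpace ℝ (Fin n)) 1)).toReal *
        ∫ r in (0 : ℝ)..δ, r ^ (n - 1) * f r := by
  have : Nonempty (Fin n) := ⟨⟨0, hn⟩⟩
  have hind : (Metric.ball (0 : EuclideanSpace ℝ (Fin n)) δ).indicator (fun x => f ‖x‖) =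
      fun x => (Iio δ).indicator f ‖x‖ := by
    ext x
    simp [indicator]
  have hpow : (fun r : ℝ => r ^ (n - 1) • (Iio δ).indicator f r) =
      (Iio δ).indicator (fun r => r ^ (n - 1) * f r) := by
    ext r
    by_cases hr : r < δ <;> simp [indicator, hr]
  rw [← integral_indicator measurableSet_ball, hind, integral_fun_norm_addHaar,
    finrank_euclideanSpace_fin, hpow, setIntegral_indicator measurableSet_Iio, Ioi_inter_Iio,
    intervalIntegral.integral_of_le hδ, integral_Ioc_eq_integral_Ioo, nsmul_eq_mul, smul_eq_mul,
    Measure.real, mul_assoc]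

/-- The radial density rewritten as `r⁻¹` times a power of `1 + ε² / r²`. -/
theorem radial_density_eq (n : ℕ) (hn : 1 ≤ n) (a : ℝ) {ε r : ℝ} (hr : 0 < r) :
    r ^ (n - 1) * (r ^ a * (ε ^ 2 + r ^ 2) ^ (-(((n : ℝ) + a) / 2))) =
      r⁻¹ * (1 + ε ^ 2 / r ^ 2) ^ (-(((n : ℝ) + a) / 2)) := by
  have hsum : ε ^ 2 + r ^ 2 = r ^ 2 * (1 + ε ^ 2 / r ^ 2) := by
    field_simp
    ring
  have hsq : (r ^ 2) ^ (-(((n : ℝ) + a) / 2)) = r ^ (-((n : ℝ) + a)) := by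
    rw [← Real.rpow_natCast r 2, ← Real.rpow_mul hr.le]
    congr 1
    push_cast
    ring
  have hpow : r ^ (n - 1) * (r ^ a * r ^ (-((n : ℝ) + a))) = r⁻¹ := by
    rw [← Real.rpow_natCast, ← Real.rpow_add hr, ← Real.rpow_add hr, ← Real.rpow_neg_one]
    congr 1
    rw [Nat.cast_sub hn]
    push_cast
    ring
  rw [hsum, Real.mul_rpow (by positivity) (by positivity), hsq, ← hpow]
  ring

theorem radial_density_le_inv (n : ℕ) (hn : 1 ≤ n) {a : ℝ} (ha : 0 ≤ a) {ε r : ℝ} (hr : 0 < r) :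
    r ^ (n - 1) * (r ^ a * (ε ^ 2 + r ^ 2) ^ (-(((n : ℝ) + a) / 2))) ≤ r⁻¹ := by
  rw [radial_density_eq n hn a hr]
  refine mul_le_of_le_one_right (by positivity) (Real.rpow_le_one_of_one_le_of_nonpos ?_ ?_)
  · exact le_add_of_nonneg_right (by positivity)
  · exact neg_nonpos.mpr (by positivity)

theorem inv_sub_le_radial_density (n : ℕ) (hn : 1 ≤ n) {a : ℝ} (ha : 0 ≤ a) {ε r : ℝ}
    (hr : 0 < r) :
    r⁻¹ - ((n : ℝ) + a) / 2 * ε ^ 2 * r ^ (-3 : ℤ) ≤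
      r ^ (n - 1) * (r ^ a * (ε ^ 2 + r ^ 2) ^ (-(((n : ℝ) + a) / 2))) := by
  rw [radial_density_eq n hn a hr]
  have hx : 0 ≤ ε ^ 2 / r ^ 2 := by positivity
  have hq : 0 ≤ ((n : ℝ) + a) / 2 := by positivity
  have hbern : 1 - ((n : ℝ) + a) / 2 * (ε ^ 2 / r ^ 2) ≤
      (1 + ε ^ 2 / r ^ 2) ^ (-(((n : ℝ) + a) / 2)) := by
    rw [Real.rpow_def_of_pos (by positivity)]
    have hlog := Real.log_le_sub_one_of_pos (show 0 < 1 + ε ^ 2 / r ^ 2 by positivity)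
    refine le_trans ?_ (Real.add_one_le_exp _)
    nlinarith [mul_le_mul_of_nonneg_left hlog hq]
  calc
    _ = r⁻¹ * (1 - ((n : ℝ) + a) / 2 * (ε ^ 2 / r ^ 2)) := by
      rw [zpow_neg]
      norm_cast
      field_simp
    _ ≤ _ := mul_le_mul_of_nonneg_left hbern (by positivity)

theorem radial_density_le_inv_scale (n : ℕ) (hn : 1 ≤ n) {a : ℝ} (ha : 0 ≤ a) {ε r : ℝ}
    (hε : 0 < ε) (hr : 0 ≤ r) (hrε : r ≤ ε) :
    r ^ (n - 1) * (r ^ a * (ε ^ 2 + r ^ 2) ^ (-(((n : ℝ) + a) / 2))) ≤ ε⁻¹ := by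
  have hbase : (ε ^ 2 + r ^ 2) ^ (-(((n : ℝ) + a) / 2)) ≤
      (ε ^ 2 + 0 ^ 2) ^ (-(((n : ℝ) + a) / 2)) :=
    Real.rpow_le_rpow_of_nonpos (by positivity) (by nlinarith) (neg_nonpos.mpr (by positivity))
  calc
    _ ≤ ε ^ (n - 1) * (ε ^ a * (ε ^ 2 + 0 ^ 2) ^ (-(((n : ℝ) + a) / 2))) := by gcongr
    _ = ε ^ (n - 1) * (ε ^ a * (0 ^ 2 + ε ^ 2) ^ (-(((n : ℝ) + a) / 2))) := by
      rw [add_comm (ε ^ 2)]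
    _ ≤ ε⁻¹ := radial_density_le_inv n hn ha hε

theorem continuous_radial_density (n : ℕ) {a : ℝ} (ha : 0 ≤ a) {ε : ℝ} (hε : 0 < ε) :
    Continuous fun r : ℝ =>
      r ^ (n - 1) * (r ^ a * (ε ^ 2 + r ^ 2) ^ (-(((n : ℝ) + a) / 2))) := by
  refine (continuous_pow _).mul ((Real.continuous_rpow_const ha).mul ?_)
  exact Continuous.rpow_const (by fun_prop) fun r => Or.inl (by positivity)

theorem radial_integral_le (n : ℕ) (hn : 1 ≤ n) {a : ℝ} (ha : 0 ≤ a) {ε δ : ℝ}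
    (hε : 0 < ε) (hεδ : ε ≤ δ) :
    ∫ r in (0 : ℝ)..δ, r ^ (n - 1) * (r ^ a * (ε ^ 2 + r ^ 2) ^ (-(((n : ℝ) + a) / 2))) ≤
      Real.log (δ / ε) + 1 := by
  have hc := continuous_radial_density n ha hε
  have h0 : (0 : ℝ) ∉ uIcc ε δ := by
    rw [uIcc_of_le hεδ]
    exact fun h => hε.not_ge h.1
  have hinner := intervalIntegral.integral_mono_on hε.le (hc.intervalIntegrable (μ := volume) 0 ε)
    (intervalIntegrable_const (c := ε⁻¹))
    fun r hr => radial_density_le_inv_scale n hn ha hε hr.1 hr.2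
  have houter := intervalIntegral.integral_mono_on hεδ (hc.intervalIntegrable (μ := volume) ε δ)
    (intervalIntegrable_inv_iff.mpr (Or.inr h0))
    fun r hr => radial_density_le_inv n hn ha (hε.trans_le hr.1)
  rw [integral_inv h0] at houter
  rw [intervalIntegral.integral_const, sub_zero, smul_eq_mul, mul_inv_cancel₀ hε.ne'] at hinner
  rw [← intervalIntegral.integral_add_adjacent_intervals (hc.intervalIntegrable (μ := volume) 0 ε)
    (hc.intervalIntegrable (μ := volume) ε δ)]
  linarith

theorem le_radial_integral (n : ℕ) (hn : 1 ≤ n) {a : ℝ} (ha : 0 ≤ a) {ε δ : ℝ}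
    (hε : 0 < ε) (hεδ : ε ≤ δ) :
    Real.log (δ / ε) - ((n : ℝ) + a) / 4 ≤
      ∫ r in (0 : ℝ)..δ, r ^ (n - 1) * (r ^ a * (ε ^ 2 + r ^ 2) ^ (-(((n : ℝ) + a) / 2))) := by
  have hc := continuous_radial_density n ha hε
  have hδ : 0 < δ := hε.trans_le hεδ
  have h0 : (0 : ℝ) ∉ uIcc ε δ := by
    rw [uIcc_of_le hεδ]
    exact fun h => hε.not_ge h.1
  have hinv : IntervalIntegrable (fun r : ℝ => r⁻¹) volume ε δ :=
    intervalIntegrable_inv_iff.mpr (Or.inr h0)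
  have hcube : IntervalIntegrable (fun r : ℝ => ((n : ℝ) + a) / 2 * ε ^ 2 * r ^ (-3 : ℤ))
      volume ε δ :=
    (intervalIntegral.intervalIntegrable_zpow (Or.inr h0)).const_mul _
  have hinner : 0 ≤ ∫ r in (0 : ℝ)..ε,
      r ^ (n - 1) * (r ^ a * (ε ^ 2 + r ^ 2) ^ (-(((n : ℝ) + a) / 2))) :=
    intervalIntegral.integral_nonneg hε.le fun r hr => by
      have := hr.1
      positivity
  have houter := intervalIntegral.integral_mono_on hεδ (hinv.sub hcube)
    (hc.intervalIntegrable (μ := volume) ε δ)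
    fun r hr => inv_sub_le_radial_density n hn ha (ε := ε) (hε.trans_le hr.1)
  rw [intervalIntegral.integral_sub hinv hcube, integral_inv h0,
    intervalIntegral.integral_const_mul, integral_zpow (Or.inr ⟨by norm_num, h0⟩)] at houter
  have htail : ((n : ℝ) + a) / 2 * ε ^ 2 *
      ((δ ^ ((-3 : ℤ) + 1) - ε ^ ((-3 : ℤ) + 1)) / (((-3 : ℤ) : ℝ) + 1)) ≤
        ((n : ℝ) + a) / 4 := by
    have hexp : (-3 : ℤ) + 1 = -(2 : ℕ) := by norm_num
    rw [hexp, zpow_neg, zpow_neg, zpow_natCast, zpow_natCast]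
    have hcancel : ε ^ 2 * (ε ^ 2)⁻¹ = 1 := mul_inv_cancel₀ (by positivity)
    have hpos : 0 ≤ ((n : ℝ) + a) * (ε ^ 2 * (δ ^ 2)⁻¹) := by positivity
    push_cast
    linear_combination (1 / 4) * hpos + (((n : ℝ) + a) / 4) * hcancel
  rw [← intervalIntegral.integral_add_adjacent_intervals (hc.intervalIntegrable (μ := volume) 0 ε)
    (hc.intervalIntegrable (μ := volume) ε δ)]
  linarith

/-- The radial integral is asymptotic to `log (1 / ε)`. -/
theorem tendsto_radial_integral_div_log (n : ℕ) (hn : 1 ≤ n) {δ : ℝ} (hδ : 0 < δ) {a : ℝ}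
    (ha : 0 ≤ a) :
    Tendsto (fun ε : ℝ => (Real.log (1 / ε))⁻¹ *
        ∫ r in (0 : ℝ)..δ, r ^ (n - 1) * (r ^ a * (ε ^ 2 + r ^ 2) ^ (-(((n : ℝ) + a) / 2))))
      (nhdsWithin 0 (Ioi 0)) (nhds 1) := by
  have hlog : Tendsto (fun ε : ℝ => Real.log (1 / ε)) (nhdsWithin 0 (Ioi 0)) atTop := by
    simpa only [one_div, Function.comp_def] using
      Real.tendsto_log_atTop.comp (tendsto_inv_nhdsGT_zero (𝕜 := ℝ))
  have hbound (c : ℝ) : Tendsto (fun ε : ℝ => 1 + (Real.log (1 / ε))⁻¹ * c)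
      (nhdsWithin 0 (Ioi 0)) (nhds 1) := by
    simpa using (hlog.inv_tendsto_atTop.mul_const c).const_add 1
  have hsmall : ∀ᶠ ε : ℝ in nhdsWithin 0 (Ioi 0), 0 < ε ∧ ε < δ :=
    Ioo_mem_nhdsGT hδ
  have hsplit {ε : ℝ} (hε : 0 < ε) : Real.log (δ / ε) = Real.log (1 / ε) + Real.log δ := by
    rw [Real.log_div hδ.ne' hε.ne', one_div, Real.log_inv]
    ring
  refine tendsto_of_tendsto_of_tendsto_of_le_of_le' (hbound (Real.log δ - ((n : ℝ) + a) / 4))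
    (hbound (Real.log δ + 1)) ?_ ?_
  · filter_upwards [hsmall, hlog.eventually_gt_atTop 0] with ε hε hpos
    have h := mul_le_mul_of_nonneg_left (le_radial_integral n hn ha hε.1 hε.2.le)
      (inv_nonneg.mpr hpos.le)
    rw [hsplit hε.1] at h
    linarith [inv_mul_cancel₀ hpos.ne']
  · filter_upwards [hsmall, hlog.eventually_gt_atTop 0] with ε hε hpos
    have h := mul_le_mul_of_nonneg_left (radial_integral_le n hn ha hε.1 hε.2.le)
      (inv_nonneg.mpr hpos.le)
    rw [hsplit hε.1] at h
    linarith [inv_mul_cancel₀ hpos.ne']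

/-- Borderline logarithmic asymptotics: with `q = (n+a)/2`,
`(log(1/ε))⁻¹ ∫_{B_δ} ‖x‖^a (ε²+‖x‖²)^{−q} dx → n ωₙ` as `ε → 0⁺`, where `ωₙ` is the
Lebesgue measure of the unit ball of `ℝⁿ`. -/
theorem weighted_bubble_log_asymptotics (n : ℕ) (hn : 1 ≤ n) (δ : ℝ) (hδ : 0 < δ)
    (a : ℝ) (ha : 0 ≤ a) :
    Tendsto (fun ε : ℝ => (Real.log (1 / ε))⁻¹ *
        ∫ x in Metric.ball (0 : EuclideanSpace ℝ (Fin n)) δ,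
          ‖x‖ ^ a * (ε ^ 2 + ‖x‖ ^ 2) ^ (-(((n : ℝ) + a) / 2)))
      (nhdsWithin 0 (Ioi 0))
      (nhds ((n : ℝ) *
        (volume (Metric.ball (0 : EuclideanSpace ℝ (Fin n)) 1)).toReal)) := by
  have hlim := (tendsto_radial_integral_div_log n hn hδ ha).const_mul
    ((n : ℝ) * (volume (Metric.ball (0 : EuclideanSpace ℝ (Fin n)) 1)).toReal)
  rw [mul_one] at hlim
  refine hlim.congr fun ε => ?_
  rw [setIntegral_ball_fun_norm n hn hδ.le
    fun r => r ^ a * (ε ^ 2 + r ^ 2) ^ (-(((n : ℝ) + a) / 2))]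
  ring
end

section
/- Let n ≥ 5 be an integer and ε > 0, and define u : ℝⁿ → ℝ by u(x) = (ε² + ‖x‖²)^{(4−n)/2}. Then u is smooth and its iterated Laplacian satisfies Δ(Δu)(x) = n(n−4)(n²−4) · ε⁴ · (ε² + ‖x‖²)^{−(n+4)/2} for all x ∈ ℝⁿ. -/
/-- The Euclidean Laplacian `Δf = Σᵢ ∂²f/∂xᵢ²` on `ℝⁿ`, expressed via the second iterated
Fréchet derivative evaluated on the standard basis vectors. -/
noncomputable def euclideanLaplacian {n : ℕ} (f : EuclideanSpace ℝ (Fin n) → ℝ)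
    (x : EuclideanSpace ℝ (Fin n)) : ℝ :=
  ∑ i : Fin n, iteratedFDeriv ℝ 2 f x
    ![EuclideanSpace.single i (1:ℝ), EuclideanSpace.single i (1:ℝ)]

open scoped ContDiff Laplacian

theorem euclideanLaplacian_eq_laplacian {n : ℕ} (f : EuclideanSpace ℝ (Fin n) → ℝ) :
    euclideanLaplacian f = Δ f := by
  funext x
  simp [euclideanLaplacian,
    InnerProductSpace.laplacian_eq_iteratedFDeriv_orthonormalBasis f
      (EuclideanSpace.basisFun (Fin n) ℝ)]

section AddNormSqRpow

variable {E : Type*} [NormedAddCommGroup E] [InnerProductSpace ℝ E] {c : ℝ}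

theorem contDiff_add_norm_sq_rpow (hc : 0 < c) (a : ℝ) {k : WithTop ℕ∞} :
    ContDiff ℝ k fun x : E => (c + ‖x‖ ^ 2) ^ a :=
  (contDiff_const.add (contDiff_norm_sq ℝ)).rpow_const_of_ne fun x => by positivity

theorem hasFDerivAt_add_norm_sq_rpow (hc : 0 < c) (a : ℝ) (x : E) :
    HasFDerivAt (fun y : E => (c + ‖y‖ ^ 2) ^ a)
      ((2 * a * (c + ‖x‖ ^ 2) ^ (a - 1)) • innerSL ℝ x) x := by
  have hx : c + ‖x‖ ^ 2 ≠ 0 := by positivity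
  convert ((hasStrictFDerivAt_norm_sq x).hasFDerivAt.const_add c).rpow_const (p := a)
    (Or.inl hx) using 1
  ext v
  simp
  ring

theorem iteratedFDeriv_two_add_norm_sq_rpow (hc : 0 < c) (a : ℝ) (x v : E) :
    iteratedFDeriv ℝ 2 (fun y : E => (c + ‖y‖ ^ 2) ^ a) x ![v, v] =
      2 * a * (c + ‖x‖ ^ 2) ^ (a - 1) * ‖v‖ ^ 2 +
        4 * a * (a - 1) * (c + ‖x‖ ^ 2) ^ (a - 2) * inner ℝ x v ^ 2 := by
  obtain ⟨L, hL⟩ : ∃ L : E →L[ℝ] E →L[ℝ] ℝ, ∀ y, L y = innerSL ℝ y :=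
    ⟨innerSL ℝ, fun _ => rfl⟩
  have hfd : fderiv ℝ (fun y : E => (c + ‖y‖ ^ 2) ^ a) =
      fun y => (2 * a * (c + ‖y‖ ^ 2) ^ (a - 1)) • L y :=
    funext fun y => hL y ▸ (hasFDerivAt_add_norm_sq_rpow hc a y).fderiv
  have hfd₂ := ((hasFDerivAt_add_norm_sq_rpow hc (a - 1) x).const_mul (2 * a)).fun_smul
    L.hasFDerivAt
  rw [iteratedFDeriv_two_apply, hfd, hfd₂.fderiv]
  simp [hL, show a - 1 - 1 = a - 2 by ring]
  ring

theorem laplacian_add_norm_sq_rpow [FiniteDimensional ℝ E] (hc : 0 < c) (a : ℝ) :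
    Δ (fun x : E => (c + ‖x‖ ^ 2) ^ a) =
      (2 * a * (Module.finrank ℝ E + 2 * a - 2)) • (fun x : E => (c + ‖x‖ ^ 2) ^ (a - 1)) +
        (-(4 * a * (a - 1) * c)) • fun x : E => (c + ‖x‖ ^ 2) ^ (a - 2) := by
  funext x
  have hx : 0 < c + ‖x‖ ^ 2 := by positivity
  have hpow : (c + ‖x‖ ^ 2) ^ (a - 1) = (c + ‖x‖ ^ 2) ^ (a - 2) * (c + ‖x‖ ^ 2) := by
    rw [← Real.rpow_add_one hx.ne']
    congr 1
    ring
  rw [InnerProductSpace.laplacian_eq_iteratedFDeriv_stdOrthonormalBasis]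
  simp only [iteratedFDeriv_two_add_norm_sq_rpow hc, Finset.sum_add_distrib, ← Finset.mul_sum,
    OrthonormalBasis.sum_sq_inner_left, OrthonormalBasis.norm_eq_one]
  simp [hpow]
  ring

end AddNormSqRpow

/-- For `n ≥ 5`, `ε > 0` and `u(x) = (ε² + ‖x‖²)^{(4−n)/2}`, the function `u` is smooth and
`Δ(Δu)(x) = n(n−4)(n²−4) ε⁴ (ε² + ‖x‖²)^{−(n+4)/2}`. -/
theorem bilaplacian_bubble (n : ℕ) (hn : 5 ≤ n) (ε : ℝ) (hε : 0 < ε) :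
    ContDiff ℝ (⊤ : ℕ∞) (fun x : EuclideanSpace ℝ (Fin n) =>
      (ε ^ 2 + ‖x‖ ^ 2) ^ ((4 - (n : ℝ)) / 2)) ∧
    ∀ x : EuclideanSpace ℝ (Fin n),
      euclideanLaplacian (euclideanLaplacian (fun y : EuclideanSpace ℝ (Fin n) =>
          (ε ^ 2 + ‖y‖ ^ 2) ^ ((4 - (n : ℝ)) / 2))) x =
        (n : ℝ) * ((n : ℝ) - 4) * ((n : ℝ) ^ 2 - 4) * ε ^ 4 *
          (ε ^ 2 + ‖x‖ ^ 2) ^ (-(((n : ℝ) + 4) / 2)) := by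
  have hc : 0 < ε ^ 2 := by positivity
  refine ⟨contDiff_add_norm_sq_rpow hc _, fun x => ?_⟩
  have smooth (a s : ℝ) :
      ContDiffAt ℝ 2 (s • fun y : EuclideanSpace ℝ (Fin n) => (ε ^ 2 + ‖y‖ ^ 2) ^ a) x :=
    ((contDiff_add_norm_sq_rpow hc a).const_smul s).contDiffAt
  rw [euclideanLaplacian_eq_laplacian, euclideanLaplacian_eq_laplacian,
    laplacian_add_norm_sq_rpow hc, (smooth _ _).laplacian_add (smooth _ _),
    InnerProductSpace.laplacian_smul _ (contDiff_add_norm_sq_rpow hc _).contDiffAt,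
    InnerProductSpace.laplacian_smul _ (contDiff_add_norm_sq_rpow hc _).contDiffAt,
    laplacian_add_norm_sq_rpow hc, laplacian_add_norm_sq_rpow hc]
  simp only [Pi.add_apply, Pi.smul_apply, smul_eq_mul, finrank_euclideanSpace_fin]
  rw [show (4 - (n : ℝ)) / 2 - 1 - 2 = (4 - (n : ℝ)) / 2 - 2 - 1 by ring,
    show (4 - (n : ℝ)) / 2 - 2 - 2 = -(((n : ℝ) + 4) / 2) by ring]
  ring
end
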